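/- Let {M_j}_{j≥1} be an increasing, logarithmically convex sequence of positive numbers such that C^j = o(M_j) as j → ∞ for every constant C > 1. Set a_n = τ(2^n)/2^n for n ≥ 1, and for each integer k ≥ 1 define f_k(x) = Σ_{n=k}^∞ a_n cos(2^n x). Then each f_k is a well-defined 2π-periodic C^∞ function on R and satisfies |f_k^{(j)}(x)| ≤ M_j for all j ≥ 1 and all x; in particular f_k belongs to the class C^#{M_j} on [0,2π]. -/

import Mathlib

open Set Filter Topology

noncomputable section

/-- `f` belongs to the class `C^#{M_j}` on `[a,b]`: there is a constant `C > 0`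
with `sup_{[a,b]} |f^{(j)}| ≤ C^j M_j` for all `j ≥ 1`. -/
def MemCSharp (M : ℕ → ℝ) (f : ℝ → ℝ) (a b : ℝ) : Prop :=
  ∃ C > 0, ∀ j : ℕ, 1 ≤ j → ∀ x ∈ Set.Icc a b, |iteratedDeriv j f x| ≤ C ^ j * M j

/-- `M` is an admissible version of the sequence `M^{(k)}_j = (j log_k j)^j`
(where `log_k` is the `k`-th iterated logarithm): positive, increasing,
logarithmically convex, and equal to `(j log_k j)^j` for all sufficiently
large `j`. -/
def IsMkSeq (k : ℕ) (M : ℕ → ℝ) : Prop :=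
  (∀ j, 0 < M j) ∧ Monotone M ∧
  (∀ j : ℕ, M (j + 1) ^ 2 ≤ M j * M (j + 2)) ∧
  ∃ J : ℕ, ∀ j ≥ J, M j = ((j : ℝ) * Real.log^[k] j) ^ j

/-- The associated function `τ(r) = inf_{j ≥ 1} M_j / r^j` of the sequence `{M_j}`. -/
def assocFn (M : ℕ → ℝ) (r : ℝ) : ℝ :=
  ⨅ j : {j : ℕ // 1 ≤ j}, M j.1 / r ^ j.1

/-- `a_n = τ(2^n)/2^n`. -/
def aseq (M : ℕ → ℝ) (n : ℕ) : ℝ := assocFn M (2 ^ n) / 2 ^ n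

/-- `f_k(x) = Σ_{n ≥ k} a_n cos(2^n x)`. -/
def lacunarySum (M : ℕ → ℝ) (k : ℕ) (x : ℝ) : ℝ :=
  ∑' n : ℕ, if k ≤ n then aseq M n * Real.cos (2 ^ n * x) else 0

lemma assocFn_nonneg (M : ℕ → ℝ) (hpos : ∀ j, 0 < M j) (n : ℕ) :
    0 ≤ assocFn M (2 ^ n) :=
  Real.iInf_nonneg fun j => div_nonneg (hpos _).le (by positivity)

lemma assocFn_le (M : ℕ → ℝ) (hpos : ∀ j, 0 < M j) (n j : ℕ) (hj : 1 ≤ j) :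
    assocFn M (2 ^ n) * (2 ^ n) ^ j ≤ M j := by
  have h : assocFn M (2 ^ n) ≤ M j / (2 ^ n) ^ j :=
    ciInf_le (f := fun j : {j : ℕ // 1 ≤ j} => M j.1 / ((2 : ℝ) ^ n) ^ j.1)
      ⟨0, by
        rintro _ ⟨i, rfl⟩
        exact div_nonneg (hpos _).le (by positivity)⟩ ⟨j, hj⟩
  rwa [le_div_iff₀ (by positivity)] at h

lemma aseq_bound (M : ℕ → ℝ) (hpos : ∀ j, 0 < M j) (n j : ℕ) :
    aseq M n * (2 ^ n) ^ j ≤ M (max j 1) / 2 ^ n := by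
  have h1 := assocFn_le M hpos n (max j 1) (le_max_right _ _)
  have h2 : ((2 : ℝ) ^ n) ^ j ≤ (2 ^ n) ^ (max j 1) :=
    pow_le_pow_right₀ (one_le_pow₀ (by norm_num)) (le_max_left _ _)
  have h3 := (mul_le_mul_of_nonneg_left h2 (assocFn_nonneg M hpos n)).trans h1
  unfold aseq
  rw [div_mul_eq_mul_div]
  gcongr

lemma aseq_nonneg (M : ℕ → ℝ) (hpos : ∀ j, 0 < M j) (n : ℕ) : 0 ≤ aseq M n :=
  div_nonneg (assocFn_nonneg M hpos n) (by positivity)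

/-- The `n`-th term of the series. -/
def lacTerm (M : ℕ → ℝ) (k n : ℕ) (x : ℝ) : ℝ :=
  if k ≤ n then aseq M n * Real.cos (2 ^ n * x) else 0

/-- The majorant of the `j`-th derivative of the `n`-th term. -/
def lacMaj (M : ℕ → ℝ) (j n : ℕ) : ℝ :=
  if n = 0 then 0 else M (max j 1) / 2 ^ n

lemma lacMaj_hasSum (M : ℕ → ℝ) (j : ℕ) : HasSum (lacMaj M j) (M (max j 1)) := by
  rw [← hasSum_nat_add_iff' 1]
  have h := hasSum_geometric_two' (M (max j 1))
  have e1 : (fun n => lacMaj M j (n + 1)) = fun n => M (max j 1) / 2 / 2 ^ n := by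
    funext n
    have : n + 1 ≠ 0 := by omega
    simp only [lacMaj, this, if_false]
    rw [div_div, pow_succ']
  have e2 : M (max j 1) - ∑ i ∈ Finset.range 1, lacMaj M j i = M (max j 1) := by
    simp [lacMaj]
  rw [e1, e2]
  exact h

lemma lacTerm_contDiff (M : ℕ → ℝ) (k n : ℕ) : ContDiff ℝ (⊤ : ℕ∞) (lacTerm M k n) := by
  unfold lacTerm
  split_ifs
  · exact contDiff_const.mul (Real.contDiff_cos.comp (contDiff_const.mul contDiff_id))
  · exact contDiff_const

lemma lacTerm_bound (M : ℕ → ℝ) (hpos : ∀ j, 0 < M j) (k : ℕ) (hk : 1 ≤ k) (j n : ℕ) (x : ℝ) :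
    ‖iteratedFDeriv ℝ j (lacTerm M k n) x‖ ≤ lacMaj M j n := by
  rw [norm_iteratedFDeriv_eq_norm_iteratedDeriv]
  by_cases h : k ≤ n
  · have e : lacTerm M k n = fun x => aseq M n * (fun x => Real.cos (2 ^ n * x)) x := by
      funext x
      simp [lacTerm, h]
    have hn : n ≠ 0 := by omega
    rw [e, iteratedDeriv_const_mul_field, iteratedDeriv_comp_const_mul Real.contDiff_cos]
    simp only [lacMaj, hn, if_false]
    refine le_trans ?_ (aseq_bound M hpos n j)
    rw [norm_mul, norm_mul, Real.norm_of_nonneg (aseq_nonneg M hpos n),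
      Real.norm_of_nonneg (by positivity : (0 : ℝ) ≤ (2 ^ n) ^ j)]
    have := Real.abs_iteratedDeriv_cos_le_one j (2 ^ n * x)
    refine mul_le_mul_of_nonneg_left ?_ (aseq_nonneg M hpos n)
    exact mul_le_of_le_one_right (by positivity) this
  · have e : lacTerm M k n = fun _ => (0 : ℝ) := by
      funext x
      simp [lacTerm, h]
    have h0 : 0 ≤ lacMaj M j n := by
      unfold lacMaj
      split_ifs
      · exact le_rfl
      · exact div_nonneg (hpos _).le (by positivity)
    rw [e]
    simpa [iteratedDeriv_const] using h0

/-- Lemma: for an increasing, logarithmically convex sequence `{M_j}` with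
`C^j = o(M_j)` for all `C > 1`, each `f_k(x) = Σ_{n ≥ k} a_n cos(2^n x)` with
`a_n = τ(2^n)/2^n` is a well-defined `2π`-periodic smooth function with
`|f_k^{(j)}| ≤ M_j` for all `j ≥ 1`; in particular `f_k ∈ C^#{M_j}` on `[0,2π]`. -/
theorem lacunarySum_mem_class
    (M : ℕ → ℝ) (hpos : ∀ j, 0 < M j) (hmono : Monotone M)
    (hlogconv : ∀ j : ℕ, M (j + 1) ^ 2 ≤ M j * M (j + 2))
    (hsmall : ∀ C : ℝ, 1 < C → Tendsto (fun j : ℕ => C ^ j / M j) atTop (𝓝 0))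
    (k : ℕ) (hk : 1 ≤ k) :
    (∀ x : ℝ, Summable fun n : ℕ =>
      if k ≤ n then aseq M n * Real.cos (2 ^ n * x) else 0) ∧
    ContDiff ℝ (⊤ : ℕ∞) (lacunarySum M k) ∧
    Function.Periodic (lacunarySum M k) (2 * Real.pi) ∧
    (∀ j : ℕ, 1 ≤ j → ∀ x : ℝ, |iteratedDeriv j (lacunarySum M k) x| ≤ M j) ∧
    MemCSharp M (lacunarySum M k) 0 (2 * Real.pi) := by
  have hs : ∀ j : ℕ, (j : ℕ∞) ≤ (⊤ : ℕ∞) → Summable (lacMaj M j) :=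
    fun j _ => (lacMaj_hasSum M j).summable
  have hb : ∀ (j n : ℕ) (x : ℝ), (j : ℕ∞) ≤ (⊤ : ℕ∞) →
      ‖iteratedFDeriv ℝ j (lacTerm M k n) x‖ ≤ lacMaj M j n :=
    fun j n x _ => lacTerm_bound M hpos k hk j n x
  have hd : ∀ j : ℕ, 1 ≤ j → ∀ x : ℝ, |iteratedDeriv j (lacunarySum M k) x| ≤ M j := by
    intro j hj x
    rw [← Real.norm_eq_abs, ← norm_iteratedFDeriv_eq_norm_iteratedDeriv]
    have h := iteratedFDeriv_tsum_apply (fun n => lacTerm_contDiff M k n) hs hb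
      (k := j) le_top x
    change iteratedFDeriv ℝ j (lacunarySum M k) x = _ at h
    rw [h]
    have h2 := tsum_of_norm_bounded (lacMaj_hasSum M j) fun n => hb j n x le_top
    rwa [max_eq_left hj] at h2
  refine ⟨fun x => ?_, contDiff_tsum (fun n => lacTerm_contDiff M k n) hs hb, fun x => ?_, hd,
    1, one_pos, fun j hj x _ => ?_⟩
  · refine Summable.of_norm_bounded (hs 0 le_top) fun n => ?_
    have := hb 0 n x le_top
    rwa [norm_iteratedFDeriv_zero] at this
  · unfold lacunarySum
    refine tsum_congr fun n => ?_
    have : (2 : ℝ) ^ n * (x + 2 * Real.pi) = 2 ^ n * x + ((2 ^ n : ℕ) : ℝ) * (2 * Real.pi) := by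
      push_cast
      ring
    rw [this, Real.cos_add_nat_mul_two_pi]
  · rw [one_pow, one_mul]
    exact hd j hj x
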